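/- arXiv:1603.08177 — 2 statements merged into one kernel-verified Lean document; each statement's English description precedes it below -/
import Mathlib

section
/- An optimistic partially naive agent can have exponential cost ratio: for every b > 1, every b' with 1 ≤ b' < b, every integer n ≥ 1, and every ε > 0, there exists a planning instance on n + 2 nodes in which the partially naive agent with true bias b and believed bias b' incurs cost C_p(s) ≥ (1 − ε)·bⁿ while the optimal cost is C_o(s) = 1; thus the worst-case cost ratio of an optimistic partially naive agent is b^{Ω(n)} in the number of nodes n. -/
/-- `IsPathTo E t u l`: `l` lists the successive vertices strictly after `u`
on a directed path from `u` to `t` along edges of `E`. -/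
def IsPathTo {n : ℕ} (E : Fin n → Fin n → Prop) (t : Fin n) :
    Fin n → List (Fin n) → Prop
  | u, [] => u = t
  | u, v :: l => E u v ∧ IsPathTo E t v l

/-- Total cost (or reward) of the path from `u` along the vertex list `l`. -/
def pathCost {n : ℕ} (c : Fin n → Fin n → ℝ) : Fin n → List (Fin n) → ℝ
  | _, [] => 0
  | u, v :: l => c u v + pathCost c v l

/-- A planning instance: a finite DAG on `Fin n` (the order on `Fin n` is a
topological order, which is WLOG for finite DAGs), nonnegative edge costs,
a source `s` and a target `t` that is reachable from every node. -/
structure PlanningInstance (n : ℕ) where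
  E : Fin n → Fin n → Prop
  c : Fin n → Fin n → ℝ
  s : Fin n
  t : Fin n
  edge_lt : ∀ u v, E u v → u < v
  c_nonneg : ∀ u v, E u v → 0 ≤ c u v
  reach : ∀ u, ∃ l, IsPathTo E t u l

/-- `Co u` is the minimum total cost of a directed path from `u` to the target. -/
def IsOptCost {n : ℕ} (G : PlanningInstance n) (Co : Fin n → ℝ) : Prop :=
  ∀ u, IsLeast {x : ℝ | ∃ l, IsPathTo G.E G.t u l ∧ pathCost G.c u l = x} (Co u)

/-- `S` is a sophisticated choice function with present-bias `b`, and `C` the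
cost it incurs: `C t = 0`, and at each `u ≠ t` the successor `S u` minimizes
`b * c u v + C v` over edges `(u, v)`, with `C u = c u (S u) + C (S u)`. -/
structure SophSpec {n : ℕ} (G : PlanningInstance n) (b : ℝ)
    (S : Fin n → Fin n) (C : Fin n → ℝ) : Prop where
  cost_t : C G.t = 0
  edge : ∀ u, u ≠ G.t → G.E u (S u)
  min : ∀ u, u ≠ G.t → ∀ v, G.E u v →
    b * G.c u (S u) + C (S u) ≤ b * G.c u v + C v
  cost : ∀ u, u ≠ G.t → C u = G.c u (S u) + C (S u)

/-- A partially naive agent with true bias `b` believing its future selves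
behave like a sophisticated agent with cost function `Cb'`: at each `u ≠ t`,
`S u` minimizes `b * c u v + Cb' v`; `C` is the incurred cost. -/
structure PartialSpec {n : ℕ} (G : PlanningInstance n) (b : ℝ)
    (Cb' : Fin n → ℝ) (S : Fin n → Fin n) (C : Fin n → ℝ) : Prop where
  cost_t : C G.t = 0
  edge : ∀ u, u ≠ G.t → G.E u (S u)
  min : ∀ u, u ≠ G.t → ∀ v, G.E u v →
    b * G.c u (S u) + Cb' (S u) ≤ b * G.c u v + Cb' v
  cost : ∀ u, u ≠ G.t → C u = G.c u (S u) + C (S u)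

/-- The fan: a zero-cost chain `0 → 1 → ⋯ → n` in which every node `u` also has an exit edge of
cost `b ^ u` to the target `n + 1`. -/
noncomputable def fan (b : ℝ) (hb : 1 < b) (n : ℕ) : PlanningInstance (n + 2) where
  E u v := u < v ∧ (v = Fin.last (n + 1) ∨ v.val = u.val + 1)
  c u v := if v = Fin.last (n + 1) then b ^ u.val else 0
  s := 0
  t := Fin.last (n + 1)
  edge_lt _ _ h := h.1
  c_nonneg u v _ := by
    split_ifs <;> positivity
  reach u := by
    by_cases hu : u = Fin.last (n + 1)
    · exact ⟨[], hu⟩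
    · exact ⟨[Fin.last (n + 1)], ⟨Fin.lt_last_iff_ne_last.mpr hu, Or.inl rfl⟩, rfl⟩

/-- The cost of leaving the fan immediately from a given node. -/
noncomputable def exitCost (b : ℝ) (n : ℕ) (u : Fin (n + 2)) : ℝ :=
  if u = Fin.last (n + 1) then 0 else b ^ u.val

/-- A potential that vanishes at the target and grows by at most the edge cost bounds the cost of
every path from below. -/
theorem le_pathCost {n : ℕ} {E : Fin n → Fin n → Prop} {c : Fin n → Fin n → ℝ} {t : Fin n}
    {p : Fin n → ℝ} (ht : p t = 0) (hp : ∀ u v, E u v → p u ≤ c u v + p v) :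
    ∀ (l : List (Fin n)) (u : Fin n), IsPathTo E t u l → p u ≤ pathCost c u l
  | [], u, h => by
    obtain rfl : u = t := h
    exact ht.le
  | v :: l, u, h => (hp u v h.1).trans (by
      simpa [pathCost] using le_pathCost ht hp l v h.2)

theorem exitCost_le_fan {b : ℝ} (hb : 1 < b) {n : ℕ} {β : ℝ} (hβb : β ≤ b)
    (u v : Fin (n + 2)) (h : (fan b hb n).E u v) :
    β * b ^ u.val ≤ β * (fan b hb n).c u v + exitCost b n v := by
  by_cases hv : v = Fin.last (n + 1)
  · simp [fan, exitCost, hv]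
  · have hs : v.val = u.val + 1 := h.2.resolve_left hv
    simp only [fan, exitCost, hv, if_false, mul_zero, zero_add, hs, pow_succ']
    gcongr

theorem fan_isOptCost {b : ℝ} (hb : 1 < b) (n : ℕ) : IsOptCost (fan b hb n) (exitCost b n) := by
  intro u
  constructor
  · by_cases hu : u = Fin.last (n + 1)
    · exact ⟨[], hu, by simp [pathCost, exitCost, hu]⟩
    · exact ⟨[Fin.last (n + 1)], ⟨⟨Fin.lt_last_iff_ne_last.mpr hu, Or.inl rfl⟩, rfl⟩,
        by simp [pathCost, exitCost, hu, fan]⟩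
  · rintro _ ⟨l, hl, rfl⟩
    refine le_pathCost (by simp [exitCost, fan]) (fun u v h => ?_) l u hl
    have hu : u ≠ Fin.last (n + 1) := (h.1.trans_le (Fin.le_last v)).ne
    simpa [exitCost, hu] using exitCost_le_fan hb hb.le u v h

theorem fan_sophSpec {b b' : ℝ} (hb : 1 < b) (hb' : b' ≤ b) (n : ℕ) :
    SophSpec (fan b hb n) b' (fun _ => Fin.last (n + 1)) (exitCost b n) where
  cost_t := by simp [exitCost, fan]
  edge u hu := ⟨Fin.lt_last_iff_ne_last.mpr hu, Or.inl rfl⟩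
  min u _ v h := by
    simpa [fan, exitCost] using exitCost_le_fan hb hb' u v h
  cost u hu := by
    have hu : u ≠ Fin.last (n + 1) := hu
    simp [fan, exitCost, hu]

/-- The successor along the chain. -/
def chainNext (n : ℕ) (u : Fin (n + 2)) : Fin (n + 2) :=
  if h : u.val + 1 < n + 2 then ⟨u.val + 1, h⟩ else Fin.last (n + 1)

theorem val_chainNext {n : ℕ} {u : Fin (n + 2)} (hu : u ≠ Fin.last (n + 1)) :
    (chainNext n u).val = u.val + 1 := by
  have h : u.val + 1 < n + 2 := by
    have := Fin.lt_last_iff_ne_last.mpr hu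
    simp only [Fin.lt_def, Fin.val_last] at this
    omega
  simp [chainNext, h]

theorem fan_partialSpec {b : ℝ} (hb : 1 < b) (n : ℕ) :
    PartialSpec (fan b hb n) b (exitCost b n) (chainNext n)
      (fun u => if u = Fin.last (n + 1) then 0 else b ^ n) where
  cost_t := by simp [fan]
  edge u hu := by
    have h := val_chainNext hu
    exact ⟨by rw [Fin.lt_def]; omega, Or.inr h⟩
  min u hu v h := by
    refine le_trans (le_of_eq ?_) (exitCost_le_fan hb le_rfl u v h)
    have hs := val_chainNext hu
    by_cases hl : chainNext n u = Fin.last (n + 1)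
    · simp [fan, exitCost, hl]
    · simp [fan, exitCost, hl, hs, pow_succ']
  cost u hu := by
    have hs := val_chainNext hu
    have hu : u ≠ Fin.last (n + 1) := hu
    by_cases hl : chainNext n u = Fin.last (n + 1)
    · have hn : u.val = n := by
        rw [hl, Fin.val_last] at hs
        omega
      simp [fan, hl, hu, hn]
    · simp [fan, hl, hu]

/-- An optimistic partially naive agent (true bias `b`,
believed bias `1 ≤ b' < b`) can have exponential cost ratio: for every
`n ≥ 1` and `ε > 0` there is a planning instance on `n + 2` nodes with
optimal cost `C_o(s) = 1` on which the agent incurs cost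
`C_p(s) ≥ (1 - ε) · bⁿ`. -/
theorem optimistic_partially_naive_exponential (b b' : ℝ) (hb : 1 < b)
    (hb'1 : 1 ≤ b') (hb' : b' < b) (n : ℕ) (hn : 1 ≤ n) (ε : ℝ) (hε : 0 < ε) :
    ∃ (G : PlanningInstance (n + 2)) (Co Cs' Cp : Fin (n + 2) → ℝ)
      (S' Sp : Fin (n + 2) → Fin (n + 2)),
      IsOptCost G Co ∧ SophSpec G b' S' Cs' ∧ PartialSpec G b Cs' Sp Cp ∧
      Co G.s = 1 ∧ (1 - ε) * b ^ n ≤ Cp G.s := by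
  have h0 : (0 : Fin (n + 2)) ≠ Fin.last (n + 1) := (Fin.last_pos).ne
  refine ⟨fan b hb n, exitCost b n, exitCost b n, _, _, _, fan_isOptCost hb n,
    fan_sophSpec hb hb'.le n, fan_partialSpec hb n, ?_, ?_⟩
  · simp [fan, exitCost, h0]
  · simp only [fan, h0, if_false]
    exact mul_le_of_le_one_left (by positivity) (by linarith)
end

section
/- A naive future-biased agent with bias parameter 0 < b < 1 has cost ratio at most 1/b: for every node u, the cost C_f(u) it incurs satisfies b · C_f(u) ≤ C_o(u). -/
/-- `S` is a naive choice function with bias `b` (minimizing `b·c(u,v) + Co v`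
over edges `(u,v)`), and `C` the cost it incurs. -/
structure NaiveSpec {n : ℕ} (G : PlanningInstance n) (b : ℝ) (Co : Fin n → ℝ)
    (S : Fin n → Fin n) (C : Fin n → ℝ) : Prop where
  cost_t : C G.t = 0
  edge : ∀ u, u ≠ G.t → G.E u (S u)
  min : ∀ u, u ≠ G.t → ∀ v, G.E u v →
    b * G.c u (S u) + Co (S u) ≤ b * G.c u v + Co v
  cost : ∀ u, u ≠ G.t → C u = G.c u (S u) + C (S u)

theorem pathCost_nonneg {n : ℕ} (G : PlanningInstance n) (u : Fin n) (l : List (Fin n))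
    (hl : IsPathTo G.E G.t u l) : 0 ≤ pathCost G.c u l := by
  induction l generalizing u with
  | nil => exact le_rfl
  | cons v l ih => exact add_nonneg (G.c_nonneg u v hl.1) (ih v hl.2)

theorem IsOptCost.nonneg {n : ℕ} {G : PlanningInstance n} {Co : Fin n → ℝ}
    (hCo : IsOptCost G Co) (u : Fin n) : 0 ≤ Co u := by
  obtain ⟨l, hl, hcost⟩ := (hCo u).1
  exact hcost ▸ pathCost_nonneg G u l hl

theorem IsOptCost.exists_edge {n : ℕ} {G : PlanningInstance n} {Co : Fin n → ℝ}
    (hCo : IsOptCost G Co) {u : Fin n} (hu : u ≠ G.t) :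
    ∃ v, G.E u v ∧ G.c u v + Co v ≤ Co u := by
  obtain ⟨l, hl, hcost⟩ := (hCo u).1
  cases l with
  | nil => exact absurd hl hu
  | cons v l =>
    refine ⟨v, hl.1, ?_⟩
    rw [← hcost]
    exact add_le_add le_rfl ((hCo v).2 ⟨l, hl.2, rfl⟩)

/-- A naive future-biased agent with parameter `0 < b < 1`
(choosing at each node a successor minimizing `b·c(u,v) + C_o(v)`) has cost
ratio at most `1/b`: for every node `u`, `b · C_f(u) ≤ C_o(u)`. -/
theorem future_biased_cost_ratio {n : ℕ} (G : PlanningInstance n) (b : ℝ)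
    (hb0 : 0 < b) (hb1 : b < 1) (Co : Fin n → ℝ) (hCo : IsOptCost G Co)
    (Sf : Fin n → Fin n) (Cf : Fin n → ℝ) (hf : NaiveSpec G b Co Sf Cf) :
    ∀ u, b * Cf u ≤ Co u := by
  intro u
  induction u using WellFoundedGT.induction with
  | ind u ih =>
    by_cases hu : u = G.t
    · rw [hu, hf.cost_t, mul_zero]
      exact hCo.nonneg G.t
    · obtain ⟨v, hv, hvcost⟩ := hCo.exists_edge hu
      have hS := ih (Sf u) (G.edge_lt _ _ (hf.edge u hu))
      have hmin := hf.min u hu v hv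
      have hbias : b * G.c u v ≤ G.c u v :=
        mul_le_of_le_one_left (G.c_nonneg u v hv) hb1.le
      rw [hf.cost u hu, mul_add]
      linarith
end
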